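/- Let S and A be nonempty finite sets, P : S → A → S → ℝ a transition function with P s a s' ≥ 0 and ∑_{s'} P s a s' = 1 for every (s,a), γ ∈ [0,1), r : S → ℝ a state reward with |r(s)| ≤ R for all s, and ρ : S → ℝ strictly positive with ∑_s ρ(s) = 1. Let D : S → A → S → ℝ, define Q̂(s,a) := ∑_{s⁺} ρ(s⁺)·D(s,a,s⁺)·r(s⁺), and let π : S → A be greedy with respect to Q̂, i.e. Q̂(s, π(s)) = max_{a} Q̂(s,a) for all s. If sqrt(∑_{s⁺} ρ(s⁺)·(D(s,a,s⁺) − M^π(s,a,s⁺)/ρ(s⁺))²) ≤ ε for every (s,a), then Q*_r(s,a) − Q^π_r(s,a) ≤ (3/(1−γ))·R·ε for all (s,a). -/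

import Mathlib

open scoped BigOperators

/-- State–action transition matrix induced by policy `π`. -/
noncomputable def policyMatrix {S A : Type*} [Fintype S] [Fintype A] [DecidableEq A]
    (P : S → A → S → ℝ) (π : S → A) : Matrix (S × A) (S × A) ℝ :=
  fun p q => if q.2 = π q.1 then P p.1 p.2 q.1 else 0

/-- Successor measure `M^π(s,a,s⁺) = ∑_{t≥0} γ^t ∑_{a⁺} (P_π^{t+1})((s,a),(s⁺,a⁺))`. -/
noncomputable def succMeas {S A : Type*} [Fintype S] [Fintype A] [DecidableEq S] [DecidableEq A]
    (P : S → A → S → ℝ) (γ : ℝ) (π : S → A) (s : S) (a : A) (sp : S) : ℝ :=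
  ∑' t : ℕ, γ ^ t * ∑ ap : A, (policyMatrix P π ^ (t + 1)) (s, a) (sp, ap)

/-- Q-function of policy `π` for state reward `r`. -/
noncomputable def Qpol {S A : Type*} [Fintype S] [Fintype A] [DecidableEq S] [DecidableEq A]
    (P : S → A → S → ℝ) (γ : ℝ) (r : S → ℝ) (π : S → A) (s : S) (a : A) : ℝ :=
  ∑ sp : S, r sp * succMeas P γ π s a sp

/-- Optimal Q-function: maximum over deterministic policies. -/
noncomputable def Qopt {S A : Type*} [Fintype S] [Fintype A] [DecidableEq S] [DecidableEq A]
    (P : S → A → S → ℝ) (γ : ℝ) (r : S → ℝ) (s : S) (a : A) : ℝ :=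
  ⨆ π : S → A, Qpol P γ r π s a

section SuccessorMeasure

variable {S A : Type*} [Fintype S] [Fintype A] [DecidableEq S] [DecidableEq A]

/-- Probability of being in state `sp` after `t + 1` steps when following `π` after the
first action. -/
noncomputable def visitProb (P : S → A → S → ℝ) (π : S → A) (sp : S) (t : ℕ) (s : S) (a : A) : ℝ :=
  ∑ ap : A, (policyMatrix P π ^ (t + 1)) (s, a) (sp, ap)

theorem visitProb_zero (P : S → A → S → ℝ) (π : S → A) (sp s : S) (a : A) :
    visitProb P π sp 0 s a = P s a sp := by
  simp [visitProb, policyMatrix]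

theorem visitProb_succ (P : S → A → S → ℝ) (π : S → A) (sp : S) (t : ℕ) (s : S) (a : A) :
    visitProb P π sp (t + 1) s a = ∑ s', P s a s' * visitProb P π sp t s' (π s') := by
  unfold visitProb
  simp_rw [pow_succ' (policyMatrix P π) (t + 1), Matrix.mul_apply, Fintype.sum_prod_type]
  rw [Finset.sum_comm]
  refine Finset.sum_congr rfl fun s' _ => ?_
  rw [Finset.sum_comm, Finset.mul_sum]
  simp [policyMatrix, ← Finset.mul_sum]

theorem visitProb_mem_Icc {P : S → A → S → ℝ} (hP0 : ∀ s a s', 0 ≤ P s a s')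
    (hP1 : ∀ s a, ∑ s' : S, P s a s' = 1) (π : S → A) (sp : S) (t : ℕ) (s : S) (a : A) :
    visitProb P π sp t s a ∈ Set.Icc 0 1 := by
  induction t generalizing s a with
  | zero =>
    rw [visitProb_zero, ← hP1 s a]
    exact ⟨hP0 s a sp, Finset.single_le_sum (fun s' _ => hP0 s a s') (Finset.mem_univ sp)⟩
  | succ t ih =>
    rw [visitProb_succ, ← hP1 s a]
    exact ⟨Finset.sum_nonneg fun s' _ => mul_nonneg (hP0 s a s') (ih s' (π s')).1,
      Finset.sum_le_sum fun s' _ => mul_le_of_le_one_right (hP0 s a s') (ih s' (π s')).2⟩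

theorem summable_discounted_visitProb {P : S → A → S → ℝ} (hP0 : ∀ s a s', 0 ≤ P s a s')
    (hP1 : ∀ s a, ∑ s' : S, P s a s' = 1) {γ : ℝ} (hγ0 : 0 ≤ γ) (hγ1 : γ < 1)
    (π : S → A) (sp s : S) (a : A) :
    Summable fun t => γ ^ t * visitProb P π sp t s a :=
  Summable.of_nonneg_of_le
    (fun t => mul_nonneg (pow_nonneg hγ0 t) (visitProb_mem_Icc hP0 hP1 π sp t s a).1)
    (fun t => mul_le_of_le_one_right (pow_nonneg hγ0 t) (visitProb_mem_Icc hP0 hP1 π sp t s a).2)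
    (summable_geometric_of_lt_one hγ0 hγ1)

theorem succMeas_eq_tsum_visitProb (P : S → A → S → ℝ) (γ : ℝ) (π : S → A) (s : S) (a : A)
    (sp : S) : succMeas P γ π s a sp = ∑' t : ℕ, γ ^ t * visitProb P π sp t s a :=
  rfl

/-- Bellman equation for the successor measure. -/
theorem succMeas_bellman {P : S → A → S → ℝ} (hP0 : ∀ s a s', 0 ≤ P s a s')
    (hP1 : ∀ s a, ∑ s' : S, P s a s' = 1) {γ : ℝ} (hγ0 : 0 ≤ γ) (hγ1 : γ < 1)
    (π : S → A) (s : S) (a : A) (sp : S) :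
    succMeas P γ π s a sp =
      P s a sp + γ * ∑ s', P s a s' * succMeas P γ π s' (π s') sp := by
  have hsum := summable_discounted_visitProb hP0 hP1 hγ0 hγ1 π sp
  simp_rw [succMeas_eq_tsum_visitProb]
  rw [(hsum s a).tsum_eq_zero_add]
  simp_rw [← tsum_mul_left]
  rw [← Summable.tsum_finsetSum fun s' _ => (hsum s' (π s')).mul_left _, ← tsum_mul_left]
  congr 1
  · simp [visitProb_zero]
  · refine tsum_congr fun t => ?_
    rw [visitProb_succ, Finset.mul_sum, Finset.mul_sum]
    exact Finset.sum_congr rfl fun s' _ => by ring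

/-- Bellman equation for the Q-function. -/
theorem Qpol_bellman {P : S → A → S → ℝ} (hP0 : ∀ s a s', 0 ≤ P s a s')
    (hP1 : ∀ s a, ∑ s' : S, P s a s' = 1) {γ : ℝ} (hγ0 : 0 ≤ γ) (hγ1 : γ < 1)
    (r : S → ℝ) (π : S → A) (s : S) (a : A) :
    Qpol P γ r π s a = ∑ s', P s a s' * (r s' + γ * Qpol P γ r π s' (π s')) := by
  have h : ∑ sp, r sp * (γ * ∑ s', P s a s' * succMeas P γ π s' (π s') sp) =
      ∑ s', P s a s' * (γ * Qpol P γ r π s' (π s')) := by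
    simp_rw [Qpol, Finset.mul_sum]
    rw [Finset.sum_comm]
    exact Finset.sum_congr rfl fun s' _ => Finset.sum_congr rfl fun sp _ => by ring
  simp_rw [mul_add, Finset.sum_add_distrib]
  rw [← h, ← Finset.sum_add_distrib, Qpol]
  refine Finset.sum_congr rfl fun sp _ => ?_
  rw [succMeas_bellman hP0 hP1 hγ0 hγ1]
  ring

/-- A policy which is `η`-greedy for its own Q-function is `γ * η / (1 - γ)`-optimal. -/
theorem Qpol_sub_Qpol_le_of_approx_greedy {P : S → A → S → ℝ} (hP0 : ∀ s a s', 0 ≤ P s a s')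
    (hP1 : ∀ s a, ∑ s' : S, P s a s' = 1) {γ : ℝ} (hγ0 : 0 ≤ γ) (hγ1 : γ < 1)
    (r : S → ℝ) {π : S → A} {η : ℝ}
    (hgreedy : ∀ s a, Qpol P γ r π s a ≤ Qpol P γ r π s (π s) + η) (π' : S → A) (s : S) (a : A) :
    Qpol P γ r π' s a - Qpol P γ r π s a ≤ γ * η / (1 - γ) := by
  have : Nonempty (S × A) := ⟨(s, a)⟩
  obtain ⟨⟨s₀, a₀⟩, hmax⟩ := Finite.exists_max
    fun p : S × A => Qpol P γ r π' p.1 p.2 - Qpol P γ r π p.1 p.2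
  set d := Qpol P γ r π' s₀ a₀ - Qpol P γ r π s₀ a₀ with hd
  have hstep : d ≤ γ * (d + η) := by
    calc d = ∑ s', P s₀ a₀ s' *
            (γ * (Qpol P γ r π' s' (π' s') - Qpol P γ r π s' (π s'))) := by
          rw [hd, Qpol_bellman hP0 hP1 hγ0 hγ1 r π', Qpol_bellman hP0 hP1 hγ0 hγ1 r π,
            ← Finset.sum_sub_distrib]
          exact Finset.sum_congr rfl fun s' _ => by ring
      _ ≤ ∑ s', P s₀ a₀ s' * (γ * (d + η)) := by
          gcongr with s' _
          · exact hP0 s₀ a₀ s'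
          · linarith [hmax (s', π' s'), hgreedy s' (π' s')]
      _ = γ * (d + η) := by rw [← Finset.sum_mul, hP1, one_mul]
  refine (hmax (s, a)).trans ?_
  rw [le_div_iff₀ (sub_pos.2 hγ1)]
  linarith

end SuccessorMeasure

theorem abs_weighted_sum_mul_le_of_sqrt_le {S : Type*} [Fintype S] {ρ x r : S → ℝ} {R ε : ℝ}
    (hρ : ∀ s, 0 ≤ ρ s) (hρ1 : ∑ s, ρ s = 1) (hR : 0 ≤ R) (hr : ∀ s, |r s| ≤ R)
    (hx : √(∑ s, ρ s * x s ^ 2) ≤ ε) : |∑ s, ρ s * x s * r s| ≤ R * ε := by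
  have hjensen : ∑ s, ρ s * |x s| ≤ √(∑ s, ρ s * x s ^ 2) := by
    refine Real.le_sqrt_of_sq_le ?_
    simpa only [sq_abs] using Real.pow_arith_mean_le_arith_mean_pow Finset.univ ρ (fun s => |x s|)
      (fun s _ => hρ s) hρ1 (fun s _ => abs_nonneg (x s)) 2
  calc |∑ s, ρ s * x s * r s| ≤ ∑ s, |ρ s * x s * r s| := Finset.abs_sum_le_sum_abs _ _
    _ ≤ ∑ s, R * (ρ s * |x s|) := by
        refine Finset.sum_le_sum fun s _ => ?_
        rw [abs_mul, abs_mul, abs_of_nonneg (hρ s), mul_comm]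
        exact mul_le_mul_of_nonneg_right (hr s) (mul_nonneg (hρ s) (abs_nonneg _))
    _ = R * ∑ s, ρ s * |x s| := by rw [Finset.mul_sum]
    _ ≤ R * ε := mul_le_mul_of_nonneg_left (hjensen.trans hx) hR

theorem uniform_successor_to_value_stability
    {S A : Type*} [Fintype S] [Fintype A] [Nonempty S] [Nonempty A]
    [DecidableEq S] [DecidableEq A]
    (P : S → A → S → ℝ) (hP0 : ∀ s a s', 0 ≤ P s a s')
    (hP1 : ∀ s a, ∑ s' : S, P s a s' = 1)
    (γ : ℝ) (hγ0 : 0 ≤ γ) (hγ1 : γ < 1)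
    (r : S → ℝ) (R : ℝ) (hr : ∀ s, |r s| ≤ R)
    (ρ : S → ℝ) (hρ : ∀ s, 0 < ρ s) (hρ1 : ∑ s : S, ρ s = 1)
    (D : S → A → S → ℝ)
    (Qhat : S → A → ℝ)
    (hQhat : ∀ s a, Qhat s a = ∑ sp : S, ρ sp * D s a sp * r sp)
    (π : S → A) (hπ : ∀ s, Qhat s (π s) = ⨆ a : A, Qhat s a)
    (ε : ℝ)
    (hε : ∀ s a, Real.sqrt (∑ sp : S, ρ sp *
      (D s a sp - succMeas P γ π s a sp / ρ sp) ^ 2) ≤ ε) :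
    ∀ s a, Qopt P γ r s a - Qpol P γ r π s a ≤ 3 / (1 - γ) * R * ε := by
  have hR : 0 ≤ R := (abs_nonneg _).trans (hr (Classical.arbitrary S))
  have hε0 : 0 ≤ ε :=
    (Real.sqrt_nonneg _).trans (hε (Classical.arbitrary S) (Classical.arbitrary A))
  have hclose (s : S) (a : A) : |Qhat s a - Qpol P γ r π s a| ≤ R * ε := by
    convert abs_weighted_sum_mul_le_of_sqrt_le (fun s => (hρ s).le) hρ1 hR hr (hε s a) using 2
    rw [hQhat, Qpol, ← Finset.sum_sub_distrib]
    refine Finset.sum_congr rfl fun sp _ => ?_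
    have := (hρ sp).ne'
    field_simp
  have hgreedy (s : S) (a : A) :
      Qpol P γ r π s a ≤ Qpol P γ r π s (π s) + 2 * (R * ε) := by
    have hle : Qhat s a ≤ Qhat s (π s) :=
      hπ s ▸ le_ciSup (Set.finite_range (Qhat s)).bddAbove a
    linarith [abs_le.1 (hclose s a), abs_le.1 (hclose s (π s))]
  intro s a
  have hbound : Qopt P γ r s a ≤ Qpol P γ r π s a + γ * (2 * (R * ε)) / (1 - γ) :=
    ciSup_le fun π' => by
      linarith [Qpol_sub_Qpol_le_of_approx_greedy hP0 hP1 hγ0 hγ1 r hgreedy π' s a]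
  have hconst : γ * (2 * (R * ε)) / (1 - γ) ≤ 3 / (1 - γ) * R * ε := by
    rw [show 3 / (1 - γ) * R * ε = 3 * (R * ε) / (1 - γ) by ring]
    have hγ : 0 < 1 - γ := sub_pos.2 hγ1
    refine div_le_div_of_nonneg_right ?_ hγ.le
    nlinarith [mul_nonneg hR hε0]
  linarith
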